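/- arXiv:2302.06437 — 2 statements merged into one kernel-verified Lean document; each statement's English description precedes it below -/
import Mathlib

section
/- Let X be an uncountable k-Fréchet–Urysohn regular Hausdorff semi-regular space with countable pseudocharacter such that the space Q_p(X,ℝ) of quasicontinuous real-valued functions on X with the topology of pointwise convergence is Fréchet–Urysohn. Then X is a Lusin space in the sense of Kunen: every nowhere dense subset of X is countable, X has at most countably many isolated points, and X is uncountable. -/
open Set Filter Topology

section Defs

variable {X : Type*}

/-- `f : X → ℝ` is quasicontinuous: for every `x` and open sets `U ∋ x`, `V ∋ f x`
there is a nonempty open `W ⊆ U` with `f '' W ⊆ V`. -/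
def Quasicontinuous [TopologicalSpace X] (f : X → ℝ) : Prop :=
  ∀ x : X, ∀ U : Set X, IsOpen U → x ∈ U → ∀ V : Set ℝ, IsOpen V → f x ∈ V →
    ∃ W : Set X, IsOpen W ∧ W.Nonempty ∧ W ⊆ U ∧ f '' W ⊆ V

/-- `Q_p(X, ℝ)`: the quasicontinuous functions with the topology of pointwise
convergence (subspace of the product topology on `X → ℝ`). -/
abbrev Qp (X : Type*) [TopologicalSpace X] : Type _ :=
  {f : X → ℝ // Quasicontinuous f}

/-- A space is semi-regular if the regular open sets (`U = int (cl U)`) form a base. -/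
def SemiRegular (X : Type*) [TopologicalSpace X] : Prop :=
  TopologicalSpace.IsTopologicalBasis {U : Set X | U = interior (closure U)}

/-- Open Whyburn space. -/
def OpenWhyburn (X : Type*) [TopologicalSpace X] : Prop :=
  ∀ A : Set X, IsOpen A → ∀ x ∈ closure A \ A,
    ∃ B : Set X, IsOpen B ∧ B ⊆ A ∧ closure B \ A = {x}

/-- A set `A` is minimally bounded if `A ⊆ cl (int A)` and `int (cl A) ⊆ A`. -/
def MinimallyBounded [TopologicalSpace X] (A : Set X) : Prop :=
  A ⊆ closure (interior A) ∧ interior (closure A) ⊆ A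

end Defs
/-- The indicator function of the closure of an open set is quasicontinuous. -/
theorem quasicontinuous_indicator_closure {X : Type*} [TopologicalSpace X] {V : Set X}
    (hV : IsOpen V) : Quasicontinuous ((closure V).indicator (fun _ => (1 : ℝ))) := by
  intro x U hU hxU T _ hxT
  by_cases hx : x ∈ closure V
  · refine ⟨U ∩ V, hU.inter hV, mem_closure_iff.1 hx U hU hxU, inter_subset_left, ?_⟩
    rintro _ ⟨y, hy, rfl⟩
    rw [indicator_of_mem hx] at hxT
    rwa [indicator_of_mem (subset_closure hy.2)]
  · refine ⟨U ∩ (closure V)ᶜ, hU.inter isClosed_closure.isOpen_compl, ⟨x, hxU, hx⟩,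
      inter_subset_left, ?_⟩
    rintro _ ⟨y, hy, rfl⟩
    rw [indicator_of_notMem hx] at hxT
    rwa [indicator_of_notMem hy.2]

/-- If `Qp X` is Fréchet–Urysohn and every point lies in the closure of an open set whose closure
meets `D` in a countable set, then `D` is countable. -/
theorem countable_of_frechetUrysohn_Qp {X : Type*} [TopologicalSpace X]
    [FrechetUrysohnSpace (Qp X)] {D : Set X}
    (h : ∀ x : X, ∃ V : Set X, IsOpen V ∧ x ∈ closure V ∧ (closure V ∩ D).Countable) :
    D.Countable := by
  choose V hVo hxV hVc using h
  have hopen (K : Finset X) : IsOpen (⋃ k ∈ K, V k) := isOpen_biUnion fun k _ => hVo k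
  let F : Finset X → Qp X := fun K => ⟨_, quasicontinuous_indicator_closure (hopen K)⟩
  have hmem {K : Finset X} {x : X} (hx : x ∈ K) : x ∈ closure (⋃ k ∈ K, V k) :=
    closure_mono (subset_biUnion_of_mem (u := V) hx) (hxV x)
  let one : Qp X := ⟨fun _ => 1, fun x U hU hx T _ hT => ⟨U, hU, ⟨x, hx⟩, subset_rfl, by
    rintro _ ⟨y, _, rfl⟩
    exact hT⟩⟩
  have hlim : Tendsto F atTop (𝓝 one) := by
    rw [tendsto_subtype_rng, tendsto_pi_nhds]
    intro x
    refine tendsto_const_nhds.congr' ?_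
    filter_upwards [eventually_ge_atTop {x}] with K hK
    exact (indicator_of_mem (hmem (hK (Finset.mem_singleton_self x))) _).symm
  obtain ⟨f, hf, hf1⟩ := mem_closure_iff_seq_limit.1
    (mem_closure_of_tendsto hlim (Eventually.of_forall fun K => mem_range_self (f := F) K))
  choose K hK using hf
  have hcount (n : ℕ) : (closure (⋃ k ∈ K n, V k) ∩ D).Countable := by
    rw [Finset.closure_biUnion, iUnion₂_inter]
    exact (K n).countable_toSet.biUnion fun k _ => hVc k
  refine (countable_iUnion hcount).mono fun d hd => ?_
  rw [tendsto_subtype_rng, tendsto_pi_nhds] at hf1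
  obtain ⟨n, hn⟩ := ((hf1 d).eventually_ne (zero_ne_one.symm : (1 : ℝ) ≠ 0)).exists
  refine mem_iUnion.2 ⟨n, ?_, hd⟩
  rw [← hK n] at hn
  exact mem_of_indicator_ne_zero (f := fun _ => (1 : ℝ)) hn

/-- A regular space of countable pseudocharacter is open Whyburn at every point which is the limit
of a sequence of points of the given open set. -/
theorem exists_isOpen_closure_diff_subset_singleton {X : Type*} [TopologicalSpace X]
    [RegularSpace X] {x : X} {G : ℕ → Set X} (hG : ∀ n, IsOpen (G n) ∧ x ∈ G n)
    (hGx : ⋂ n, G n = {x}) {U : Set X} (hU : IsOpen U) {u : ℕ → X} (huU : ∀ n, u n ∈ U)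
    (hu : Tendsto u atTop (𝓝 x)) :
    ∃ V : Set X, IsOpen V ∧ x ∈ closure V ∧ closure V \ U ⊆ {x} := by
  have hC (n : ℕ) : ∃ C ∈ 𝓝 x, IsClosed C ∧ C ⊆ G n :=
    exists_mem_nhds_isClosed_subset ((hG n).1.mem_nhds (hG n).2)
  choose C hCx hCc hCG using hC
  obtain ⟨φ, hφ, hφC⟩ : ∃ φ : ℕ → ℕ, StrictMono φ ∧ ∀ n, ∀ m ≤ n, u (φ n) ∈ interior (C m) := by
    refine extraction_forall_of_eventually
      (P := fun n k => ∀ m ≤ n, u k ∈ interior (C m)) fun n => ?_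
    exact (eventually_all_finite (finite_Iic n)).2 fun m _ =>
      hu.eventually_mem (interior_mem_nhds.2 (hCx m))
  have hW (n : ℕ) : ∃ W : Set X, IsOpen W ∧ u (φ n) ∈ W ∧ closure W ⊆ U ∧
      ∀ m ≤ n, closure W ⊆ C m := by
    have hN : U ∩ ⋂ m ∈ Iic n, interior (C m) ∈ 𝓝 (u (φ n)) :=
      inter_mem (hU.mem_nhds (huU _)) <| (biInter_mem (finite_Iic n)).2 fun m hm =>
        isOpen_interior.mem_nhds (hφC n m hm)
    obtain ⟨T, hT, hTc, hTN⟩ := exists_mem_nhds_isClosed_subset hN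
    have hcl : closure (interior T) ⊆ T := closure_minimal interior_subset hTc
    refine ⟨interior T, isOpen_interior, mem_interior_iff_mem_nhds.2 hT,
      fun y hy => (hTN (hcl hy)).1, fun m hm y hy => ?_⟩
    exact interior_subset (mem_iInter₂.1 (hTN (hcl hy)).2 m hm)
  choose W hWo huW hWU hWC using hW
  refine ⟨⋃ n, W n, isOpen_iUnion hWo, mem_closure_of_tendsto (hu.comp hφ.tendsto_atTop)
    (Eventually.of_forall fun n => mem_iUnion.2 ⟨n, huW n⟩), ?_⟩
  rintro y ⟨hy, hyU⟩
  rw [← hGx]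
  refine mem_iInter.2 fun m => hCG m ?_
  have hsub : ⋃ n, W n ⊆ (⋃ n ∈ Iio m, W n) ∪ C m := by
    refine iUnion_subset fun n z hz => ?_
    rcases lt_or_ge n m with h | h
    · exact Or.inl (mem_iUnion₂.2 ⟨n, h, hz⟩)
    · exact Or.inr (hWC n m h (subset_closure hz))
  have hy' := closure_mono hsub hy
  rw [closure_union, (hCc m).closure_eq, (finite_Iio m).closure_biUnion] at hy'
  refine hy'.resolve_left fun h => ?_
  obtain ⟨n, _, hn⟩ := mem_iUnion₂.1 h
  exact hyU (hWU n hn)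

theorem qp_frechetUrysohn_kFU_pseudocharacter_lusin
    (X : Type*) [TopologicalSpace X] [T2Space X] [RegularSpace X] (hsr : SemiRegular X)
    [Uncountable X]
    (hpsi : ∀ x : X, ∃ U : ℕ → Set X, (∀ n, IsOpen (U n) ∧ x ∈ U n) ∧ (⋂ n, U n) = {x})
    (hkFU : ∀ U : Set X, IsOpen U → ∀ x ∈ closure U,
      ∃ u : ℕ → X, (∀ n, u n ∈ U) ∧ Filter.Tendsto u Filter.atTop (nhds x))
    (hFU : FrechetUrysohnSpace (Qp X)) :
    (∀ A : Set X, IsNowhereDense A → A.Countable) ∧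
      ({x : X | IsOpen ({x} : Set X)}).Countable ∧ Uncountable X := by
  refine ⟨fun A hA => ?_, ?_, inferInstance⟩
  · refine Countable.mono subset_closure (countable_of_frechetUrysohn_Qp fun x => ?_)
    by_cases hx : x ∈ closure A
    · obtain ⟨G, hG, hGx⟩ := hpsi x
      have hU : IsOpen (closure A)ᶜ := isClosed_closure.isOpen_compl
      have hxU : x ∈ closure (closure A)ᶜ := by
        have hAi : interior (closure A) = ∅ := hA
        simp [closure_compl, hAi]
      obtain ⟨u, huU, hu⟩ := hkFU _ hU x hxU
      obtain ⟨V, hVo, hxV, hV⟩ := exists_isOpen_closure_diff_subset_singleton hG hGx hU huU hu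
      exact ⟨V, hVo, hxV, (countable_singleton x).mono
        fun y hy => hV ⟨hy.1, fun h => h hy.2⟩⟩
    · obtain ⟨T, hT, hTc, hTA⟩ :=
        exists_mem_nhds_isClosed_subset (isClosed_closure.isOpen_compl.mem_nhds hx)
      refine ⟨interior T, isOpen_interior, subset_closure (mem_interior_iff_mem_nhds.2 hT), ?_⟩
      refine countable_empty.mono fun y hy => ?_
      exact hTA (closure_minimal interior_subset hTc hy.1) hy.2
  · set D := {x : X | IsOpen ({x} : Set X)}
    have hDo {S : Set X} (hS : S ⊆ D) : IsOpen S := by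
      rw [← biUnion_of_singleton S]
      exact isOpen_biUnion fun x hx => hS hx
    refine countable_of_frechetUrysohn_Qp fun x => ?_
    by_cases hx : x ∈ closure D
    · obtain ⟨u, huD, hu⟩ := hkFU D (hDo subset_rfl) x hx
      refine ⟨range u, hDo (range_subset_iff.2 huD), mem_closure_of_tendsto hu
        (Eventually.of_forall mem_range_self), (countable_range u).mono ?_⟩
      rintro d ⟨hd, hdD⟩
      obtain ⟨_, rfl, hy⟩ := mem_closure_iff.1 hd {d} hdD rfl
      exact hy
    · refine ⟨(closure D)ᶜ, isClosed_closure.isOpen_compl, subset_closure hx,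
        countable_empty.mono ?_⟩
      rintro d ⟨hd, hdD⟩
      obtain ⟨y, hy, hyD⟩ := mem_closure_iff.1 hd D (hDo subset_rfl) hdD
      exact hyD (subset_closure hy)
end

section
/- Let X be a Hausdorff semi-regular open Whyburn space. Then the space Q_p(X,ℝ) of quasicontinuous real-valued functions on X with the topology of pointwise convergence is Fréchet–Urysohn at the point 0 (the constant zero function) if and only if X satisfies the selection principle S₁(Ω^s, Γ^s): for every sequence (𝒰_n)_{n∈ℕ} of ω-covers of X consisting of minimally bounded sets there exists a choice U_n ∈ 𝒰_n for each n such that {U_n : n ∈ ℕ} is a γ-cover of X consisting of minimally bounded sets. -/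
open Set Filter Topology

section Covers

variable {X : Type*}

/-- An ω-cover: every finite subset of `X` is contained in some member. -/
def IsOmegaCover (𝒰 : Set (Set X)) : Prop :=
  ∀ F : Set X, F.Finite → ∃ U ∈ 𝒰, F ⊆ U

/-- A γ-cover: every point of `X` lies outside only finitely many members. -/
def IsGammaCover (𝒰 : Set (Set X)) : Prop :=
  ∀ x : X, {U ∈ 𝒰 | x ∉ U}.Finite

/-- The selection principle `S₁(Ω^s, Γ^s)`. -/
def S1OmegaGammaMB (X : Type*) [TopologicalSpace X] : Prop :=
  ∀ 𝒰 : ℕ → Set (Set X),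
    (∀ n, (∀ U ∈ 𝒰 n, MinimallyBounded U) ∧ IsOmegaCover (𝒰 n)) →
    ∃ U : ℕ → Set X, (∀ n, U n ∈ 𝒰 n) ∧ (∀ n, MinimallyBounded (U n)) ∧
      IsGammaCover (Set.range U)

/-- Fréchet–Urysohn at a point. -/
def FrechetUrysohnAt {Y : Type*} [TopologicalSpace Y] (y : Y) : Prop :=
  ∀ A : Set Y, y ∈ closure A →
    ∃ u : ℕ → Y, (∀ n, u n ∈ A) ∧ Filter.Tendsto u Filter.atTop (nhds y)

theorem quasicontinuous_const [TopologicalSpace X] (c : ℝ) :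
    Quasicontinuous (fun _ : X => c) := by
  intro x U hU hxU V hV hfV
  exact ⟨U, hU, ⟨x, hxU⟩, subset_rfl, by rintro y ⟨z, _, rfl⟩; exact hfV⟩

end Covers

/-! ### Minimally bounded sets -/

section MinimallyBounded

variable {X : Type*} [TopologicalSpace X]

theorem minimallyBounded_of_subset_closure {B V : Set X} (hB : IsOpen B)
    (h₁ : interior (closure B) ⊆ V) (h₂ : V ⊆ closure B) : MinimallyBounded V := by
  have hBV : B ⊆ interior V :=
    interior_maximal ((interior_maximal subset_closure hB).trans h₁) hB
  refine ⟨h₂.trans (closure_mono hBV), ?_⟩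
  exact (interior_mono (closure_minimal h₂ isClosed_closure)).trans h₁

theorem MinimallyBounded.interior_closure_interior {U : Set X} (hU : MinimallyBounded U) :
    interior (closure (interior U)) = interior U := by
  refine subset_antisymm ?_ (interior_maximal subset_closure isOpen_interior)
  exact interior_maximal
    ((interior_mono (closure_mono interior_subset)).trans hU.2) isOpen_interior

theorem minimallyBounded_compl_interior_closure {Q : Set X} :
    MinimallyBounded (interior (closure Q))ᶜ := by
  have h : closure (closure Q)ᶜ = (interior (closure Q))ᶜ := closure_compl
  exact minimallyBounded_of_subset_closure (B := (closure Q)ᶜ) isClosed_closure.isOpen_compl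
    (h ▸ interior_subset) h.ge

theorem MinimallyBounded.diff_closure {U G : Set X} (hU : MinimallyBounded U) (hG : IsOpen G) :
    MinimallyBounded (U \ closure G) := by
  refine minimallyBounded_of_subset_closure (B := interior U ∩ (closure G)ᶜ)
    (isOpen_interior.inter isClosed_closure.isOpen_compl) ?_ ?_
  · intro y hy
    refine ⟨hU.2 (interior_mono (closure_mono (inter_subset_left.trans interior_subset)) hy), ?_⟩
    intro hyG
    obtain ⟨z, hz, hzG⟩ := mem_closure_iff.1 hyG _ isOpen_interior hy
    obtain ⟨w, hwG, hw⟩ := mem_closure_iff.1 (interior_subset hz) G hG hzG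
    exact hw.2 (subset_closure hwG)
  · rintro y ⟨hy, hyG⟩
    rw [inter_comm]
    exact isClosed_closure.isOpen_compl.inter_closure ⟨hyG, hU.1 hy⟩

theorem minimallyBounded_inter_union_compl {G W : Set X} (hG : interior (closure G) = G)
    (hW : interior (closure W) = W) : MinimallyBounded (G ∩ W ∪ Gᶜ) := by
  have hGo : IsOpen G := hG ▸ isOpen_interior
  have hWo : IsOpen W := hW ▸ isOpen_interior
  have hc : closure (closure G)ᶜ = Gᶜ := by rw [closure_compl, hG]
  refine minimallyBounded_of_subset_closure (B := G ∩ W ∪ (closure G)ᶜ)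
    ((hGo.inter hWo).union isClosed_closure.isOpen_compl) ?_ ?_
  · intro y hy
    by_cases hyG : y ∈ G
    · refine Or.inl ⟨hyG, hW ▸ ?_⟩
      refine mem_interior.2 ⟨G ∩ interior (closure (G ∩ W ∪ (closure G)ᶜ)), ?_,
        hGo.inter isOpen_interior, hyG, hy⟩
      rintro z ⟨hzG, hz⟩
      have := interior_subset hz
      rw [closure_union, hc] at this
      exact closure_mono inter_subset_right (this.resolve_right fun h => h hzG)
    · exact Or.inr hyG
  · rw [closure_union, hc]
    exact union_subset_union_left _ subset_closure

theorem interior_closure_inter {U V : Set X} (hU : interior (closure U) = U)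
    (hV : interior (closure V) = V) : interior (closure (U ∩ V)) = U ∩ V := by
  refine subset_antisymm (subset_inter ?_ ?_) (interior_maximal subset_closure ?_)
  · exact (interior_mono (closure_mono inter_subset_left)).trans hU.le
  · exact (interior_mono (closure_mono inter_subset_right)).trans hV.le
  · exact (hU ▸ isOpen_interior : IsOpen U).inter (hV ▸ isOpen_interior)

theorem MinimallyBounded.quasicontinuous_indicator {U : Set X} (hU : MinimallyBounded U) :
    Quasicontinuous (Uᶜ.indicator fun _ => (1 : ℝ)) := by
  intro x G hG hx V _ hxV
  by_cases hxU : x ∈ U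
  · obtain ⟨z, hzG, hzU⟩ := mem_closure_iff.1 (hU.1 hxU) G hG hx
    refine ⟨G ∩ interior U, hG.inter isOpen_interior, ⟨z, hzG, hzU⟩, inter_subset_left, ?_⟩
    rintro _ ⟨y, hy, rfl⟩
    have hyU : y ∈ U := interior_subset hy.2
    simpa [indicator, hxU, hyU] using hxV
  · have : x ∈ closure (closure U)ᶜ := by
      rw [closure_compl]; exact fun h => hxU (hU.2 h)
    obtain ⟨z, hzG, hzU⟩ := mem_closure_iff.1 this G hG hx
    refine ⟨G ∩ (closure U)ᶜ, hG.inter isClosed_closure.isOpen_compl, ⟨z, hzG, hzU⟩,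
      inter_subset_left, ?_⟩
    rintro _ ⟨y, hy, rfl⟩
    have hyU : y ∉ U := fun h => hy.2 (subset_closure h)
    simpa [indicator, hxU, hyU] using hxV

/-- In a Hausdorff space a minimally bounded set can be shrunk off a point while keeping a given
finite part of it. -/
theorem MinimallyBounded.exists_subset_notMem [T2Space X] {U F : Set X}
    (hU : MinimallyBounded U) (hF : F.Finite) (hFU : F ⊆ U) {x : X} (hx : x ∉ F) :
    ∃ V, MinimallyBounded V ∧ V ⊆ U ∧ F ⊆ V ∧ x ∉ V := by
  obtain ⟨G, O, hG, hO, hxG, hFO, hGO⟩ :=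
    SeparatedNhds.of_isCompact_isCompact (isCompact_singleton (x := x)) hF.isCompact
      (disjoint_singleton_left.2 hx)
  refine ⟨U \ closure G, hU.diff_closure hG, sdiff_subset, fun y hy => ⟨hFU hy, fun hyG => ?_⟩,
    fun h => h.2 (subset_closure (hxG rfl))⟩
  exact (hGO.closure_left hO).le_bot ⟨hyG, hFO hy⟩

end MinimallyBounded

/-! ### From the selection principle to the Fréchet–Urysohn property -/

section Selection

variable {X : Type*} [TopologicalSpace X]

theorem Quasicontinuous.exists_minimallyBounded {f : X → ℝ} (hf : Quasicontinuous f) (ε : ℝ) :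
    ∃ U, MinimallyBounded U ∧ {x | |f x| < ε} ⊆ U ∧ ∀ x ∈ U, |f x| ≤ ε := by
  set S := {x | |f x| < ε}
  have hsemi : S ⊆ closure (interior S) := by
    intro x hx
    rw [mem_closure_iff]
    intro O hO hxO
    obtain ⟨W, hW, ⟨w, hw⟩, hWO, hfW⟩ := hf x O hO hxO {y | |y| < ε}
      (isOpen_lt continuous_abs continuous_const) hx
    exact ⟨w, hWO hw, mem_interior.2 ⟨W, fun y hy => hfW ⟨y, hy, rfl⟩, hW, hw⟩⟩
  have hcl : closure S = closure (interior S) :=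
    (closure_minimal hsemi isClosed_closure).antisymm (closure_mono interior_subset)
  refine ⟨S ∪ interior (closure S), ?_, subset_union_left, ?_⟩
  · refine minimallyBounded_of_subset_closure (B := interior S) isOpen_interior ?_ ?_
    · rw [← hcl]; exact subset_union_right
    · exact union_subset hsemi (hcl ▸ interior_subset)
  · rintro x (hx | hx)
    · exact le_of_lt hx
    · by_contra! hlt
      obtain ⟨W, hW, ⟨w, hw⟩, hWO, hfW⟩ := hf x _ isOpen_interior hx {y | ε < |y|}
        (isOpen_lt continuous_const continuous_abs) hlt
      obtain ⟨z, hzW, hz⟩ := mem_closure_iff.1 (interior_subset (hWO hw)) W hW hw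
      have h₁ : ε < |f z| := hfW ⟨z, hzW, rfl⟩
      exact lt_asymm h₁ hz

theorem S1OmegaGammaMB.exists_eventually_mem [T2Space X] (h : S1OmegaGammaMB X)
    {𝒰 : ℕ → Set (Set X)} (hmb : ∀ n, ∀ U ∈ 𝒰 n, MinimallyBounded U)
    (hω : ∀ n, IsOmegaCover (𝒰 n)) :
    ∃ U : ℕ → Set X, (∀ n, U n ∈ 𝒰 n) ∧ ∀ x, ∀ᶠ n in atTop, x ∈ U n := by
  rcases finite_or_infinite X with hX | hX
  · choose U hU hFU using fun n => hω n univ finite_univ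
    exact ⟨U, hU, fun x => Eventually.of_forall fun n => hFU n (mem_univ x)⟩
  let p := Infinite.natEmbedding X
  -- each set belongs to only finitely many of the following families
  let 𝒱 : ℕ → Set (Set X) := fun n =>
    {V | MinimallyBounded V ∧ (∃ U ∈ 𝒰 n, V ⊆ U) ∧ (∀ i < n, p i ∈ V) ∧ ∃ i, p i ∉ V}
  obtain ⟨V, hV, -, hγ⟩ := h 𝒱 fun n => ⟨fun V hV => hV.1, fun F hF => by
    have hF' : (F ∪ p '' Iio n).Finite := hF.union ((finite_Iio n).image _)
    obtain ⟨U, hU, hFU⟩ := hω n _ hF'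
    obtain ⟨_, ⟨i, rfl⟩, hi⟩ := (infinite_range_of_injective p.injective).exists_notMem_finite hF'
    obtain ⟨V, hVmb, hVU, hFV, hiV⟩ := (hmb n U hU).exists_subset_notMem hF' hFU hi
    exact ⟨V, ⟨hVmb, ⟨U, hU, hVU⟩, fun j hj => hFV (Or.inr ⟨j, hj, rfl⟩), i, hiV⟩,
      subset_union_left.trans hFV⟩⟩
  choose U hU hVU using fun n => (hV n).2.1
  refine ⟨U, hU, fun x => ?_⟩
  have hfib : ∀ W ∈ {W ∈ range V | x ∉ W}, (V ⁻¹' {W}).Finite := by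
    rintro W ⟨⟨n, rfl⟩, -⟩
    obtain ⟨i, hi⟩ := (hV n).2.2.2
    refine (finite_Iic i).subset fun k hk => ?_
    by_contra hik
    have : p i ∈ V k := (hV k).2.2.1 i (not_le.1 hik)
    rw [show V k = V n from hk] at this
    exact hi this
  have hfin : {n | x ∉ V n}.Finite := by
    refine ((hγ x).biUnion hfib).subset fun n hn => ?_
    exact mem_biUnion (show V n ∈ {W ∈ range V | x ∉ W} from ⟨⟨n, rfl⟩, hn⟩) rfl
  have hev := hfin.eventually_cofinite_notMem
  rw [Nat.cofinite_eq_atTop] at hev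
  filter_upwards [hev] with n hn
  exact hVU n (not_not.1 hn)

theorem S1OmegaGammaMB.frechetUrysohnAt_zero [T2Space X] (h : S1OmegaGammaMB X) :
    FrechetUrysohnAt (⟨fun _ => 0, quasicontinuous_const 0⟩ : Qp X) := by
  intro A hA
  choose U hUmb hUlt hUle using fun (f : Qp X) (n : ℕ) =>
    f.2.exists_minimallyBounded (1 / ((n : ℝ) + 1))
  obtain ⟨V, hV, hx⟩ := h.exists_eventually_mem (𝒰 := fun n => (fun f => U f n) '' A)
    (by rintro n _ ⟨f, -, rfl⟩; exact hUmb f n) (by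
      intro n F hF
      have hO : IsOpen {g : Qp X | ∀ x ∈ F, |g.1 x| < 1 / ((n : ℝ) + 1)} := by
        have : {g : Qp X | ∀ x ∈ F, |g.1 x| < 1 / ((n : ℝ) + 1)} =
            ⋂ x ∈ F, {g : Qp X | |g.1 x| < 1 / ((n : ℝ) + 1)} := by
          ext; simp
        rw [this]
        refine hF.isOpen_biInter fun x _ => isOpen_lt ?_ continuous_const
        exact continuous_abs.comp ((continuous_apply x).comp continuous_subtype_val)
      obtain ⟨f, hf, hfA⟩ := mem_closure_iff.1 hA _ hO (by
        intro x _
        simpa using (by positivity : (0 : ℝ) < (n : ℝ) + 1))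
      exact ⟨U f n, ⟨f, hfA, rfl⟩, fun x hx => hUlt f n (hf x hx)⟩)
  choose f hfA hfV using hV
  refine ⟨f, hfA, tendsto_subtype_rng.2 (tendsto_pi_nhds.2 fun x => ?_)⟩
  refine squeeze_zero_norm' ?_ tendsto_one_div_add_atTop_nhds_zero_nat
  filter_upwards [hx x] with n hn
  rw [← hfV n] at hn
  exact hUle (f n) n x hn

end Selection

/-! ### Sequences extracted from ω-covers -/

section GammaSequence

variable {X : Type*} [TopologicalSpace X]

/-- Every ω-cover by minimally bounded sets contains a sequence converging to the whole space. -/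
def HasGammaSequences (X : Type*) [TopologicalSpace X] : Prop :=
  ∀ 𝒰 : Set (Set X), (∀ U ∈ 𝒰, MinimallyBounded U) → IsOmegaCover 𝒰 →
    ∃ V : ℕ → Set X, (∀ k, V k ∈ 𝒰) ∧ ∀ x, ∀ᶠ k in atTop, x ∈ V k

theorem FrechetUrysohnAt.hasGammaSequences
    (h : FrechetUrysohnAt (⟨fun _ => 0, quasicontinuous_const 0⟩ : Qp X)) :
    HasGammaSequences X := by
  intro 𝒰 hmb hω
  let A : Set (Qp X) := {f | ∃ U ∈ 𝒰, f.1 = Uᶜ.indicator fun _ => (1 : ℝ)}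
  have h0 : (⟨fun _ => 0, quasicontinuous_const 0⟩ : Qp X) ∈ closure A := by
    rw [closure_subtype, mem_closure_iff]
    intro O hO h0
    obtain ⟨F, u, hu, hFO⟩ := isOpen_pi_iff.1 hO _ h0
    obtain ⟨U, hU, hFU⟩ := hω F F.finite_toSet
    refine ⟨Uᶜ.indicator fun _ => (1 : ℝ), hFO fun x hx => ?_,
      ⟨_, (hmb U hU).quasicontinuous_indicator⟩, ⟨U, hU, rfl⟩, rfl⟩
    have : x ∈ U := hFU hx
    simpa [indicator, this] using (hu x hx).2
  obtain ⟨f, hfA, hf⟩ := h A h0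
  choose V hV hfV using hfA
  refine ⟨V, hV, fun x => ?_⟩
  have hx := tendsto_pi_nhds.1 (tendsto_subtype_rng.1 hf) x
  filter_upwards [hx.eventually (gt_mem_nhds (zero_lt_one' ℝ))] with k hk
  by_contra hxV
  rw [hfV k] at hk
  simp [indicator, hxV] at hk

theorem HasGammaSequences.exists_tendsto [T2Space X] [Infinite X] (h : HasGammaSequences X)
    {𝒰 : ℕ → Set (Set X)} (hmb : ∀ n, ∀ U ∈ 𝒰 n, MinimallyBounded U)
    (hω : ∀ n, IsOmegaCover (𝒰 n)) :
    ∃ (r : ℕ → ℕ) (U : ℕ → Set X), Tendsto r atTop atTop ∧ (∀ k, U k ∈ 𝒰 (r k)) ∧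
      ∀ x, ∀ᶠ k in atTop, x ∈ U k := by
  let p := Infinite.natEmbedding X
  obtain ⟨V, hV, hx⟩ := h {V | MinimallyBounded V ∧ ∃ n, p n ∉ V ∧ ∃ U ∈ 𝒰 n, V ⊆ U}
    (fun V hV => hV.1) (by
      intro F hF
      obtain ⟨_, ⟨n, rfl⟩, hn⟩ :=
        (infinite_range_of_injective p.injective).exists_notMem_finite hF
      obtain ⟨U, hU, hFU⟩ := hω n F hF
      obtain ⟨V, hVmb, hVU, hFV, hnV⟩ := (hmb n U hU).exists_subset_notMem hF hFU hn
      exact ⟨V, ⟨hVmb, n, hnV, U, hU, hVU⟩, hFV⟩)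
  choose r hr U hU hVU using fun k => (hV k).2
  refine ⟨r, U, ?_, hU, fun x => (hx x).mono fun k hk => hVU k hk⟩
  refine tendsto_atTop.2 fun n => ?_
  have : ∀ᶠ k in atTop, ∀ i ∈ Iio n, p i ∈ V k :=
    (eventually_all_finite (finite_Iio n)).2 fun i _ => hx (p i)
  filter_upwards [this] with k hk
  by_contra! hlt
  exact hr k (hk _ hlt)

/-- Selection over a regular open set, for ω-covers by regular open sets. -/
theorem HasGammaSequences.exists_eventually_mem_of_regularOpen [T2Space X] [Infinite X]
    (h : HasGammaSequences X) {G : Set X} (hG : interior (closure G) = G)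
    {𝒲 : ℕ → Set (Set X)} (hreg : ∀ n, ∀ W ∈ 𝒲 n, interior (closure W) = W)
    (hω : ∀ n, ∀ F : Set X, F.Finite → F ⊆ G → ∃ W ∈ 𝒲 n, F ⊆ W) :
    ∃ W : ℕ → Set X, (∀ n, W n ∈ 𝒲 n) ∧ ∀ x ∈ G, ∀ᶠ n in atTop, x ∈ W n := by
  have hinter : ∀ (W : ℕ → Set X), (∀ n, W n ∈ 𝒲 n) → ∀ n,
      interior (closure (⋂ i ≤ n, W i)) = ⋂ i ≤ n, W i := by
    intro W hW n
    induction n with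
    | zero => simpa using hreg 0 _ (hW 0)
    | succ n ih =>
      rw [Set.biInter_le_succ]
      exact interior_closure_inter ih (hreg _ _ (hW _))
  obtain ⟨r, V, hr, hV, hx⟩ := h.exists_tendsto
    (𝒰 := fun n => {V | ∃ W : ℕ → Set X, (∀ i, W i ∈ 𝒲 i) ∧ V = G ∩ (⋂ i ≤ n, W i) ∪ Gᶜ})
    (by
      rintro n _ ⟨W, hW, rfl⟩
      exact minimallyBounded_inter_union_compl hG (hinter W hW n))
    (by
      intro n F hF
      choose W hW hFW using fun i => hω i (F ∩ G) (hF.inter_of_left G) inter_subset_right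
      refine ⟨_, ⟨W, hW, rfl⟩, fun x hxF => ?_⟩
      by_cases hxG : x ∈ G
      · exact Or.inl ⟨hxG, mem_iInter₂.2 fun i _ => hFW i ⟨hxF, hxG⟩⟩
      · exact Or.inr hxG)
  choose W hW hVW using hV
  choose k hk using fun n => ((hr.eventually_ge_atTop n).and (eventually_ge_atTop n)).exists
  refine ⟨fun n => W (k n) n, fun n => hW _ _, fun x hxG => ?_⟩
  have hktop : Tendsto k atTop atTop := tendsto_atTop_mono (fun n => (hk n).2) tendsto_id
  filter_upwards [hktop.eventually (hx x)] with n hn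
  rw [hVW] at hn
  rcases hn with hn | hn
  · exact mem_iInter₂.1 hn.2 n (hk n).1
  · exact absurd hxG hn

end GammaSequence

/-! ### Smallness of nowhere dense sets and of disjoint open families -/

section Smallness

variable {X : Type*} [TopologicalSpace X]

theorem isNowhereDense_closure_sdiff {O : Set X} (hO : IsOpen O) :
    IsNowhereDense (closure O \ O) := by
  rw [← hO.frontier_eq, IsNowhereDense, isClosed_frontier.closure_eq, ← frontier_compl,
    interior_frontier hO.isClosed_compl]

theorem OpenWhyburn.exists_isOpen_closure_inter_subset [T1Space X] (hw : OpenWhyburn X)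
    {N : Set X} (hN : IsClosed N) (hint : interior N = ∅) (x : X) :
    ∃ B, IsOpen B ∧ x ∈ closure B ∧ closure B ∩ N ⊆ {x} := by
  have hA : IsOpen (N ∪ {x})ᶜ := (hN.union isClosed_singleton).isOpen_compl
  by_cases hx : x ∈ closure (N ∪ {x})ᶜ
  · obtain ⟨B, hB, -, hBx⟩ := hw _ hA x ⟨hx, fun h => h (Or.inr rfl)⟩
    refine ⟨B, hB, (hBx.ge rfl).1, fun y hy => hBx.le ⟨hy.1, fun h => h (Or.inl hy.2)⟩⟩
  · rw [closure_compl, notMem_compl_iff] at hx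
    have hempty : interior (N ∪ {x}) \ {x} = ∅ := by
      rw [← subset_empty_iff, ← hint]
      refine interior_maximal ?_ (isOpen_interior.sdiff isClosed_singleton)
      rintro y ⟨hy, hyx⟩
      exact (interior_subset hy).resolve_right hyx
    have hsing : interior (N ∪ {x}) = {x} :=
      (sdiff_eq_empty.1 hempty).antisymm (singleton_subset_iff.2 hx)
    refine ⟨{x}, hsing ▸ isOpen_interior, subset_closure rfl, ?_⟩
    rw [closure_singleton]
    exact inter_subset_left

theorem HasGammaSequences.countable_of_isNowhereDense [T1Space X] (hγ : HasGammaSequences X)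
    (hw : OpenWhyburn X) {N : Set X} (hN : IsNowhereDense N) : N.Countable := by
  obtain ⟨V, hV, hx⟩ := hγ {V | MinimallyBounded V ∧ (V ∩ closure N).Finite}
    (fun V hV => hV.1) (by
      intro F hF
      choose B hB hxB hBN using hw.exists_isOpen_closure_inter_subset isClosed_closure hN
      have hcl : closure (⋃ x ∈ F, B x) = ⋃ x ∈ F, closure (B x) := hF.closure_biUnion B
      have hFcl : F ⊆ closure (⋃ x ∈ F, B x) := by
        rw [hcl]; exact fun x hxF => mem_biUnion hxF (hxB x)
      refine ⟨interior (closure (⋃ x ∈ F, B x)) ∪ F,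
        ⟨minimallyBounded_of_subset_closure (isOpen_biUnion fun x _ => hB x) subset_union_left
          (union_subset interior_subset hFcl), hF.subset ?_⟩, subset_union_right⟩
      rintro y ⟨hy | hy, hyN⟩
      · have := interior_subset hy
        rw [hcl] at this
        obtain ⟨x, hxF, hyx⟩ := mem_iUnion₂.1 this
        rwa [hBN x ⟨hyx, hyN⟩]
      · exact hy)
  refine (countable_iUnion fun k => (hV k).2.countable).mono fun x hxN => ?_
  obtain ⟨k, hk⟩ := (hx x).exists
  exact mem_iUnion.2 ⟨k, hk, subset_closure hxN⟩

theorem HasGammaSequences.countable_isolated [T1Space X] (hγ : HasGammaSequences X)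
    (hw : OpenWhyburn X) : {x : X | IsOpen {x}}.Countable := by
  set I := {x : X | IsOpen {x}}
  have hopen : ∀ S ⊆ I, IsOpen S := fun S hS => by
    rw [← biUnion_of_singleton S]; exact isOpen_biUnion fun x hx => hS hx
  by_contra hunc
  have hIinf : Infinite I := by
    by_contra h
    rw [not_infinite_iff_finite] at h
    exact hunc (to_countable I)
  have hN : (closure I \ I).Countable :=
    hγ.countable_of_isNowhereDense hw (isNowhereDense_closure_sdiff (hopen I subset_rfl))
  obtain ⟨e⟩ : Nonempty (I × I ≃ I) := by
    rw [← Cardinal.eq, Cardinal.mk_prod, Cardinal.lift_id,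
      Cardinal.mul_eq_self (Cardinal.aleph0_le_mk I)]
  -- a half of `I` whose complement still accumulates at all limit points of `I`
  let S : I → Set X := fun i => range fun j => (e (i, j) : X)
  have hSI : ∀ i, S i ⊆ I := by rintro i _ ⟨j, rfl⟩; exact (e (i, j)).2
  obtain ⟨i, hi⟩ : ∃ i, closure I \ I ⊆ closure (I \ S i) := by
    by_contra! h
    choose x hx hxS using fun i => not_subset.1 (h i)
    have hinj : Function.Injective x := by
      intro i j hij
      by_contra hne
      have hcov : I ⊆ (I \ S i) ∪ (I \ S j) := by
        intro y hy
        by_contra hyn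
        simp only [mem_union, Set.mem_sdiff, hy, true_and, not_or, not_not] at hyn
        obtain ⟨⟨a, ha⟩, ⟨b, hb⟩⟩ := hyn
        have := e.injective (Subtype.ext (ha.trans hb.symm))
        exact hne (Prod.ext_iff.1 this).1
      have := closure_mono hcov (hx i).1
      rw [closure_union] at this
      rcases this with h | h
      · exact hxS i h
      · rw [hij] at h; exact hxS j h
    have : Countable (closure I \ I : Set X) := hN.to_subtype
    have : Countable I := (show Function.Injective fun i => (⟨x i, hx i⟩ : (closure I \ I : Set X))
      from fun i j h => hinj (congrArg Subtype.val h)).countable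
    exact hunc (to_countable I)
  obtain ⟨V, hV, hx⟩ := hγ ((fun F => (S i \ F)ᶜ) '' {F | F.Finite})
    (by
      rintro _ ⟨F, -, rfl⟩
      have hCI : S i \ F ⊆ I := sdiff_subset.trans (hSI i)
      have hC := hopen _ hCI
      have hreg : interior (closure (S i \ F)) = S i \ F := by
        refine subset_antisymm (fun y hy => ?_) (interior_maximal subset_closure hC)
        have hyI : y ∈ I := by
          by_contra hyI
          have hyc : y ∈ closure (I \ S i) :=
            hi ⟨closure_mono hCI (interior_subset hy), hyI⟩
          obtain ⟨z, hz, hzI⟩ := mem_closure_iff.1 hyc _ isOpen_interior hy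
          obtain ⟨w, rfl, hw⟩ := mem_closure_iff.1 (interior_subset hz) {z} hzI.1 rfl
          exact hzI.2 hw.1
        obtain ⟨w, rfl, hw⟩ := mem_closure_iff.1 (interior_subset hy) {y} hyI rfl
        exact hw
      show MinimallyBounded (S i \ F)ᶜ
      rw [← hreg]
      exact minimallyBounded_compl_interior_closure)
    (fun F hF => ⟨_, ⟨F, hF, rfl⟩, fun x hx h => h.2 hx⟩)
  choose F hF hFV using hV
  have hScount : (S i).Countable := by
    refine (countable_iUnion fun k => (hF k).countable).mono fun x hxS => ?_
    obtain ⟨k, hk⟩ := (hx x).exists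
    rw [← hFV k] at hk
    exact mem_iUnion.2 ⟨k, not_not.1 fun h => hk ⟨hxS, h⟩⟩
  have : Countable (S i) := hScount.to_subtype
  have : Countable I := (show Function.Injective fun j => (⟨e (i, j), j, rfl⟩ : S i) from
    fun j k h => by
      have hjk : (e (i, j) : X) = e (i, k) := congrArg (fun z : S i => (z : X)) h
      exact congrArg Prod.snd (e.injective (Subtype.ext hjk))).countable
  exact hunc (to_countable I)

theorem HasGammaSequences.countable_of_pairwiseDisjoint [T1Space X] (hγ : HasGammaSequences X)
    (hw : OpenWhyburn X) {𝒢 : Set (Set X)} (hopen : ∀ G ∈ 𝒢, IsOpen G)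
    (hne : ∀ G ∈ 𝒢, G.Nonempty) (hd : 𝒢.PairwiseDisjoint id) : 𝒢.Countable := by
  choose p hp using fun G : 𝒢 => hne G G.2
  have heq : ∀ G G' : 𝒢, p G' ∈ G.1 → G' = G := fun G G' h => by
    by_contra hne'
    exact (hd G'.2 G.2 fun h' => hne' (Subtype.ext h')).le_bot ⟨hp G', h⟩
  have hnd : IsNowhereDense (range p \ {x | IsOpen {x}}) := by
    rw [IsNowhereDense, ← not_nonempty_iff_eq_empty]
    rintro ⟨x, hx⟩
    obtain ⟨_, hT, ⟨G, rfl⟩, hG⟩ := mem_closure_iff.1 (interior_subset hx) _ isOpen_interior hx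
    refine hG ?_
    have hGo := hopen G G.2
    suffices interior (closure (range p \ {x | IsOpen {x}})) ∩ G = {p G} from
      show IsOpen {p G} from this ▸ isOpen_interior.inter hGo
    refine subset_antisymm ?_ (singleton_subset_iff.2 ⟨hT, hp G⟩)
    rintro y ⟨hy, hyG⟩
    by_contra hyp
    obtain ⟨_, hz, ⟨G', rfl⟩, -⟩ := mem_closure_iff.1 (interior_subset hy) (G.1 \ {p G})
      (hGo.sdiff isClosed_singleton) ⟨hyG, hyp⟩
    exact hz.2 (congrArg p (heq G G' hz.1))
  have hrange : (range p).Countable :=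
    ((hγ.countable_isolated hw).union (hγ.countable_of_isNowhereDense hw hnd)).mono fun x hx => by
      by_cases hxi : IsOpen {x}
      · exact Or.inl hxi
      · exact Or.inr ⟨hx, hxi⟩
  have : Countable (range p) := hrange.to_subtype
  have : Countable 𝒢 := (show Function.Injective fun G => (⟨p G, G, rfl⟩ : range p) from
    fun G G' h => by
      have hGG : p G = p G' := congrArg Subtype.val h
      exact heq G' G (hGG ▸ hp G')).countable
  exact to_countable 𝒢

/-- A countable set of points lying on the boundary of regular open sets has countable closure. -/
theorem HasGammaSequences.countable_closure [T2Space X] [Infinite X] (hγ : HasGammaSequences X)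
    (hw : OpenWhyburn X) {D : Set X} (hD : D.Countable)
    (hsplit : ∀ d ∈ D, ∃ P, IsOpen P ∧ d ∈ closure P ∧ d ∉ interior (closure P)) :
    (closure D).Countable := by
  rcases D.eq_empty_or_nonempty with rfl | hne
  · simp
  obtain ⟨d, rfl⟩ := hD.exists_eq_range hne
  choose! P hPo hP hP' using hsplit
  obtain ⟨r, V, hr, hV, hx⟩ := hγ.exists_tendsto
    (𝒰 := fun n => {V | ∃ H : ℕ → Set X, (∀ j, IsOpen (H j) ∧ d j ∈ H j) ∧
      V = (interior (closure (⋃ j ∈ Iic n, P (d j) ∩ H j)))ᶜ})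
    (by rintro n _ ⟨H, -, rfl⟩; exact minimallyBounded_compl_interior_closure)
    (by
      intro n F hF
      have hH : ∀ j, ∃ H, (IsOpen H ∧ d j ∈ H) ∧ Disjoint (closure H) (F \ {d j}) := fun j => by
        obtain ⟨H, O, hHo, hO, hdH, hFO, hHO⟩ :=
          SeparatedNhds.of_isCompact_isCompact (isCompact_singleton (x := d j))
            (hF.subset sdiff_subset : (F \ {d j}).Finite).isCompact
            (disjoint_singleton_left.2 fun h => h.2 rfl)
        exact ⟨H, ⟨hHo, hdH rfl⟩, (hHO.closure_left hO).mono_right hFO⟩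
      choose H hHo hHF using hH
      refine ⟨_, ⟨H, hHo, rfl⟩, fun x hxF hxQ => ?_⟩
      have hcl : closure (⋃ j ∈ Iic n, P (d j) ∩ H j) = ⋃ j ∈ Iic n, closure (P (d j) ∩ H j) :=
        (finite_Iic n).closure_biUnion _
      -- near `x` only the pieces attached to `x` itself can occur
      let O := interior (closure (⋃ j ∈ Iic n, P (d j) ∩ H j)) ∩
        ⋂ j ∈ {j | j ∈ Iic n ∧ d j ≠ x}, (closure (H j))ᶜ
      have hO : IsOpen O := isOpen_interior.inter
        (((finite_Iic n).subset fun j hj => hj.1).isOpen_biInter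
          fun j _ => isClosed_closure.isOpen_compl)
      have hxO : x ∈ O := ⟨hxQ, mem_iInter₂.2 fun j hj hxH =>
        (hHF j).le_bot ⟨hxH, hxF, fun h => hj.2 h.symm⟩⟩
      have hsub : ∀ y ∈ O, ∃ j, d j = x ∧ y ∈ closure (P x) := by
        rintro y ⟨hy, hy'⟩
        have := interior_subset hy
        rw [hcl] at this
        obtain ⟨j, hj, hyj⟩ := mem_iUnion₂.1 this
        have hjx : d j = x := by
          by_contra hjx
          exact mem_iInter₂.1 hy' j ⟨hj, hjx⟩ (closure_mono inter_subset_right hyj)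
        exact ⟨j, hjx, hjx ▸ closure_mono inter_subset_left hyj⟩
      obtain ⟨j, rfl, -⟩ := hsub x hxO
      exact hP' _ ⟨j, rfl⟩
        (interior_maximal (fun y hy => (hsub y hy).choose_spec.2) hO hxO))
  choose H hH hHV using hV
  have hT : ∀ k, IsNowhereDense ((⋂ l ≥ k, V l) ∩ closure (range d)) := by
    intro k
    rw [IsNowhereDense, ← not_nonempty_iff_eq_empty]
    rintro ⟨x, hx⟩
    have hxd : x ∈ closure (range d) :=
      closure_minimal inter_subset_right isClosed_closure (interior_subset hx)
    obtain ⟨_, hdO, j, rfl⟩ := mem_closure_iff.1 hxd _ isOpen_interior hx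
    obtain ⟨l, hlj, hlk⟩ := ((hr.eventually_ge_atTop j).and (eventually_ge_atTop k)).exists
    obtain ⟨z, hz, hzP⟩ := mem_closure_iff.1 (hP (d j) ⟨j, rfl⟩) _
      (isOpen_interior.inter (hH l j).1) ⟨hdO, (hH l j).2⟩
    have hVl : IsClosed (V l) := by rw [hHV l]; exact isOpen_interior.isClosed_compl
    have hzV : z ∈ V l := closure_minimal
      (inter_subset_left.trans (biInter_subset_of_mem (show l ≥ k from hlk))) hVl
      (interior_subset hz.1)
    rw [hHV l] at hzV
    refine hzV (interior_maximal subset_closure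
      (isOpen_biUnion fun i _ => (hPo _ ⟨i, rfl⟩).inter (hH l i).1) ?_)
    exact mem_biUnion (show j ∈ Iic (r l) from hlj) ⟨hzP, hz.2⟩
  refine (countable_iUnion fun k => hγ.countable_of_isNowhereDense hw (hT k)).mono fun x hxd => ?_
  obtain ⟨k, hk⟩ := eventually_atTop.1 (hx x)
  exact mem_iUnion.2 ⟨k, mem_iInter₂.2 hk, hxd⟩

end Smallness

/-! ### From the Fréchet–Urysohn property to the selection principle -/

section Diagonal

variable {X : Type*}

/-- If each member of a countable family of sets admits a selection that is robust under passing
to subsequences, then a single selection works for all of them. -/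
theorem exists_diagonal_selection (U : ℕ → ℕ → Set X) (Z : ℕ → Set X)
    (h : ∀ i, ∀ M : ℕ → Set ℕ, (∀ n, (M n).Infinite) →
      ∃ M' : ℕ → Set ℕ, (∀ n, M' n ⊆ M n ∧ (M' n).Infinite) ∧
        ∀ x ∈ Z i, ∀ᶠ n in atTop, ∀ m ∈ M' n, x ∈ U n m) :
    ∃ m : ℕ → ℕ, ∀ i, ∀ x ∈ Z i, ∀ᶠ n in atTop, x ∈ U n (m n) := by
  choose next hnext hZ using h
  let s : ℕ → {M : ℕ → Set ℕ // ∀ n, (M n).Infinite} :=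
    Nat.rec ⟨fun _ => univ, fun _ => infinite_univ⟩
      fun i M => ⟨next i M.1 M.2, fun n => (hnext i M.1 M.2 n).2⟩
  have hanti : ∀ n, Antitone fun i => (s i).1 n := fun n =>
    antitone_nat_of_succ_le fun i => (hnext i (s i).1 (s i).2 n).1
  choose m hm using fun n => ((s (n + 1)).2 n).nonempty
  refine ⟨m, fun i x hx => ?_⟩
  filter_upwards [hZ i (s i).1 (s i).2 x hx, eventually_ge_atTop i] with n hn hin
  exact hn _ (hanti n (Nat.succ_le_succ hin) (hm n))

variable [TopologicalSpace X]

theorem SemiRegular.exists_pairwiseDisjoint (hsr : SemiRegular X) {O : Set X} (hO : IsOpen O) :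
    ∃ 𝒢 : Set (Set X), (∀ G ∈ 𝒢, interior (closure G) = G ∧ G.Nonempty ∧ G ⊆ O) ∧
      𝒢.PairwiseDisjoint id ∧ O ⊆ closure (⋃₀ 𝒢) := by
  obtain ⟨𝒢, h𝒢⟩ := zorn_subset
    {𝒢 : Set (Set X) | (∀ G ∈ 𝒢, interior (closure G) = G ∧ G.Nonempty ∧ G ⊆ O) ∧
      𝒢.PairwiseDisjoint id} fun c hc hchain =>
    ⟨⋃₀ c, ⟨fun G ⟨𝒢, h𝒢, hG⟩ => (hc h𝒢).1 G hG,
      (pairwiseDisjoint_sUnion hchain.directedOn).2 fun 𝒢 h𝒢 => (hc h𝒢).2⟩,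
      fun 𝒢 h𝒢 => subset_sUnion_of_mem h𝒢⟩
  refine ⟨𝒢, h𝒢.prop.1, h𝒢.prop.2, fun x hx => ?_⟩
  by_contra hxc
  obtain ⟨G, hG, hxG, hGO⟩ := hsr.exists_subset_of_mem_open
    (show x ∈ O ∩ (closure (⋃₀ 𝒢))ᶜ from ⟨hx, hxc⟩) (hO.inter isClosed_closure.isOpen_compl)
  have hdisj : ∀ G' ∈ 𝒢, Disjoint G G' := fun G' hG' =>
    disjoint_left.2 fun y hy hy' => (hGO hy).2 (subset_closure ⟨G', hG', hy'⟩)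
  have hmem : G ∈ 𝒢 := h𝒢.le_of_ge (y := insert G 𝒢)
    ⟨forall_mem_insert.2 ⟨⟨hG.symm, ⟨x, hxG⟩, fun y hy => (hGO hy).1⟩, h𝒢.prop.1⟩,
      h𝒢.prop.2.insert fun G' hG' _ => hdisj G' hG'⟩ (subset_insert G 𝒢) (mem_insert G 𝒢)
  exact disjoint_left.1 (hdisj G hmem) hxG hxG

theorem HasGammaSequences.exists_infinite_selection [T2Space X] [Infinite X]
    (hγ : HasGammaSequences X) {U : ℕ → ℕ → Set X} (hmb : ∀ n m, MinimallyBounded (U n m))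
    (hU : ∀ n x, ∀ᶠ m in atTop, x ∈ U n m) {G : Set X} (hG : interior (closure G) = G)
    (hGU : ∀ n m, G ∩ U n m ⊆ interior (U n m)) {M : ℕ → Set ℕ} (hM : ∀ n, (M n).Infinite) :
    ∃ M' : ℕ → Set ℕ, (∀ n, M' n ⊆ M n ∧ (M' n).Infinite) ∧
      ∀ x ∈ G, ∀ᶠ n in atTop, ∀ m ∈ M' n, x ∈ U n m := by
  obtain ⟨W, hW, hx⟩ := hγ.exists_eventually_mem_of_regularOpen hG
    (𝒲 := fun q => (fun m => interior (U q.unpair.1 m)) '' {m ∈ M q.unpair.1 | q.unpair.2 ≤ m})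
    (by rintro q _ ⟨m, -, rfl⟩; exact (hmb _ m).interior_closure_interior)
    (by
      intro q F hF hFG
      obtain ⟨k, hk⟩ := eventually_atTop.1
        ((eventually_all_finite hF).2 fun x _ => hU q.unpair.1 x)
      obtain ⟨m, hmM, hm⟩ := (hM q.unpair.1).exists_gt (max k q.unpair.2)
      refine ⟨_, ⟨m, ⟨hmM, (le_max_right _ _).trans hm.le⟩, rfl⟩, fun x hxF => ?_⟩
      exact hGU _ _ ⟨hFG hxF, hk m ((le_max_left _ _).trans hm.le) x hxF⟩)
  choose m hm hmW using hW
  refine ⟨fun n => range fun l => m (Nat.pair n l), fun n => ⟨?_, ?_⟩, fun x hxG => ?_⟩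
  · rintro _ ⟨l, rfl⟩
    simpa using (hm (Nat.pair n l)).1
  · refine infinite_of_forall_exists_gt fun l => ⟨_, ⟨l + 1, rfl⟩, ?_⟩
    simpa using (hm (Nat.pair n (l + 1))).2
  · obtain ⟨k, hk⟩ := eventually_atTop.1 (hx x hxG)
    filter_upwards [eventually_ge_atTop k] with n hn
    rintro _ ⟨l, rfl⟩
    have := hk (Nat.pair n l) (hn.trans (Nat.left_le_pair n l))
    rw [← hmW] at this
    simpa using interior_subset this

theorem HasGammaSequences.s1OmegaGammaMB [T2Space X] (hγ : HasGammaSequences X)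
    (hsr : SemiRegular X) (hw : OpenWhyburn X) : S1OmegaGammaMB X := by
  intro 𝒰 h𝒰
  suffices ∃ U : ℕ → Set X, (∀ n, U n ∈ 𝒰 n) ∧ ∀ x, ∀ᶠ n in atTop, x ∈ U n by
    obtain ⟨U, hU, hx⟩ := this
    refine ⟨U, hU, fun n => (h𝒰 n).1 _ (hU n), fun x => ?_⟩
    have hfin : {n | x ∉ U n}.Finite := by
      have := hx x
      rwa [← Nat.cofinite_eq_atTop, eventually_cofinite] at this
    refine (hfin.image U).subset ?_
    rintro _ ⟨⟨n, rfl⟩, hn⟩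
    exact ⟨n, hn, rfl⟩
  rcases finite_or_infinite X with hX | hX
  · choose U hU hFU using fun n => (h𝒰 n).2 univ finite_univ
    exact ⟨U, hU, fun x => Eventually.of_forall fun n => hFU n (mem_univ x)⟩
  choose U hU𝒰 hU using fun n => hγ (𝒰 n) (h𝒰 n).1 (h𝒰 n).2
  have hmb : ∀ n m, MinimallyBounded (U n m) := fun n m => (h𝒰 n).1 _ (hU𝒰 n m)
  let D := ⋃ n, ⋃ m, U n m \ interior (U n m)
  have hD : D.Countable := countable_iUnion fun n => countable_iUnion fun m => by
    refine hγ.countable_of_isNowhereDense hw ?_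
    exact (isNowhereDense_closure_sdiff isOpen_interior).mono
      (sdiff_subset_sdiff_left (hmb n m).1)
  have hDcl : (closure D).Countable := hγ.countable_closure hw hD fun d hd => by
    obtain ⟨n, m, hd, hd'⟩ := mem_iUnion₂.1 hd
    exact ⟨interior (U n m), isOpen_interior, (hmb n m).1 hd,
      (hmb n m).interior_closure_interior.symm ▸ hd'⟩
  obtain ⟨𝒢, h𝒢, hdisj, hdense⟩ :=
    hsr.exists_pairwiseDisjoint (isClosed_closure (s := D)).isOpen_compl
  have h𝒢o : ∀ G ∈ 𝒢, IsOpen G := fun G hG => (h𝒢 G hG).1 ▸ isOpen_interior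
  have h𝒢c : 𝒢.Countable :=
    hγ.countable_of_pairwiseDisjoint hw h𝒢o (fun G hG => (h𝒢 G hG).2.1) hdisj
  have hrest : (⋃₀ 𝒢)ᶜ.Countable := by
    have hnd := isNowhereDense_closure_sdiff (isOpen_sUnion h𝒢o)
    refine (hDcl.union (hγ.countable_of_isNowhereDense hw hnd)).mono fun x hx => ?_
    by_cases hxD : x ∈ closure D
    · exact Or.inl hxD
    · exact Or.inr ⟨hdense hxD, hx⟩
  have hcover : ∀ x, ∃ Z ∈ 𝒢 ∪ singleton '' (⋃₀ 𝒢)ᶜ, x ∈ Z := fun x => by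
    by_cases hx : x ∈ ⋃₀ 𝒢
    · obtain ⟨G, hG, hxG⟩ := hx
      exact ⟨G, Or.inl hG, hxG⟩
    · exact ⟨{x}, Or.inr ⟨x, hx, rfl⟩, rfl⟩
  obtain ⟨Z, hZ⟩ := (h𝒢c.union (hrest.image singleton)).exists_eq_range
    (let ⟨Z, hZ, _⟩ := hcover (Classical.arbitrary X); ⟨Z, hZ⟩)
  obtain ⟨m, hm⟩ := exists_diagonal_selection U Z fun i M hM => by
    rcases (hZ.ge ⟨i, rfl⟩ : Z i ∈ 𝒢 ∪ singleton '' (⋃₀ 𝒢)ᶜ) with hG | ⟨x, -, hx⟩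
    · refine hγ.exists_infinite_selection hmb hU (h𝒢 _ hG).1 (fun n m y hy => ?_) hM
      by_contra hyU
      exact (h𝒢 _ hG).2.2 hy.1 (subset_closure (mem_iUnion₂.2 ⟨n, m, hy.2, hyU⟩))
    · rw [← hx]
      choose k hk using fun n => eventually_atTop.1 (hU n x)
      refine ⟨fun n => M n \ Iio (k n), fun n => ⟨sdiff_subset, (hM n).sdiff (finite_Iio _)⟩, ?_⟩
      rintro _ rfl
      exact Eventually.of_forall fun n m hm => hk n m (not_lt.1 hm.2)
  refine ⟨fun n => U n (m n), fun n => hU𝒰 n _, fun x => ?_⟩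
  obtain ⟨_, hZx, hx⟩ := hcover x
  rw [hZ] at hZx
  obtain ⟨i, rfl⟩ := hZx
  exact hm i x hx

end Diagonal

theorem qp_frechetUrysohnAt_zero_iff_s1
    (X : Type*) [TopologicalSpace X] [T2Space X] (hsr : SemiRegular X)
    (hw : OpenWhyburn X) :
    FrechetUrysohnAt (⟨fun _ => 0, quasicontinuous_const 0⟩ : Qp X) ↔
      S1OmegaGammaMB X := by
  exact ⟨fun h => h.hasGammaSequences.s1OmegaGammaMB hsr hw, fun h => h.frechetUrysohnAt_zero⟩
end
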